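/- arXiv:2208.12293 — 2 statements merged into one kernel-verified Lean document; each statement's English description precedes it below -/
import Mathlib

section
/- If f ∈ ℤ[x_1,...,x_n] and its reduction f̄ modulo a prime p satisfies deg(f) = deg(f̄) and f̄ is irreducible over the algebraic closure of 𝔽_p, then f is irreducible over ℂ. -/
open MvPolynomial

/-- A weak form of the Nullstellensatz: a nontrivial finite type algebra over a field has a point
in every algebraically closed extension. -/
theorem nonempty_algHom_of_finiteType (E A L : Type*) [Field E] [CommRing A] [Nontrivial A]
    [Algebra E A] [Algebra.FiniteType E A] [Field L] [Algebra E L] [IsAlgClosed L] :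
    Nonempty (A →ₐ[E] L) := by
  obtain ⟨M, hM⟩ := Ideal.exists_maximal A
  let := Ideal.Quotient.field M
  have := finite_of_finite_type_of_isJacobsonRing E (A ⧸ M)
  have : Module.IsTorsionFree E (A ⧸ M) :=
    Module.isTorsionFree_iff_algebraMap_injective.mpr (algebraMap E (A ⧸ M)).injective
  exact ⟨(IsAlgClosed.lift : A ⧸ M →ₐ[E] L).comp (Ideal.Quotient.mkₐ E M)⟩

namespace MvPolynomial

variable {σ : Type*}

theorem totalDegree_map_le_totalDegree {R S : Type*} [CommSemiring R] [CommSemiring S]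
    (φ : R →+* S) (f : MvPolynomial σ R) : (map φ f).totalDegree ≤ f.totalDegree :=
  Finset.sup_mono (support_map_subset φ f)

theorem totalDegree_map_eq_of_injective {R S : Type*} [CommSemiring R] [CommSemiring S]
    {φ : R →+* S} (hφ : Function.Injective φ) (f : MvPolynomial σ R) :
    (map φ f).totalDegree = f.totalDegree := by
  rw [totalDegree, totalDegree, support_map_of_injective f hφ]

theorem isUnit_iff_totalDegree_eq_zero {K : Type*} [Field K] {f : MvPolynomial σ K}
    (hf : f ≠ 0) : IsUnit f ↔ f.totalDegree = 0 := by
  rw [isUnit_iff_totalDegree_of_isReduced]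
  refine ⟨And.right, fun h ↦ ⟨isUnit_iff_ne_zero.mpr fun h0 ↦ hf ?_, h⟩⟩
  rw [totalDegree_eq_zero_iff_eq_C.mp h, h0, C_0]

theorem exists_coeff_ne_zero_of_totalDegree_ne_zero {R : Type*} [CommSemiring R]
    {f : MvPolynomial σ R} (hf : f.totalDegree ≠ 0) : ∃ m ≠ 0, f.coeff m ≠ 0 := by
  by_contra! h
  refine hf (Nat.le_zero.mp (Finset.sup_le fun m hm ↦ ?_))
  rcases eq_or_ne m 0 with rfl | hm0
  · simp
  · exact absurd (h m hm0) (mem_support_iff.mp hm)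

theorem not_isUnit_of_coeff_ne_zero {R : Type*} [CommRing R] [IsReduced R]
    {f : MvPolynomial σ R} {m : σ →₀ ℕ} (hm : m ≠ 0) (hf : f.coeff m ≠ 0) : ¬ IsUnit f :=
  fun h ↦ hf ((isUnit_iff.mp h).2 m hm).eq_zero

/-- A nonzero polynomial over a field is a scalar multiple of a polynomial over a given valuation
subring with nonzero reduction. -/
theorem exists_eq_C_mul_map_subtype {K : Type*} [Field K] (V : ValuationSubring K)
    {g : MvPolynomial σ K} (hg : g ≠ 0) :
    ∃ (c : K) (g₁ : MvPolynomial σ V),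
      g = C c * map V.subtype g₁ ∧ map (IsLocalRing.residue V) g₁ ≠ 0 := by
  obtain ⟨m, hm, hmax⟩ := g.support.exists_max_image (fun m ↦ V.valuation (g.coeff m))
    (support_nonempty.mpr hg)
  have hc : g.coeff m ≠ 0 := mem_support_iff.mp hm
  obtain ⟨g₁, hg₁⟩ : C (g.coeff m)⁻¹ * g ∈ Set.range (map V.subtype) := by
    rw [mem_range_map_iff_coeffs_subset]
    intro x hx
    obtain ⟨k, hk, rfl⟩ := mem_coeffs_iff.mp hx
    refine ⟨⟨_, (V.valuation_le_one_iff (coeff k (C (g.coeff m)⁻¹ * g))).mp ?_⟩, rfl⟩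
    rw [coeff_C_mul]
    by_cases hk' : g.coeff k = 0
    · simp [hk']
    · rw [map_mul, map_inv₀]
      have h0 : V.valuation (g.coeff m) ≠ 0 := by simpa using hc
      calc (V.valuation (g.coeff m))⁻¹ * V.valuation (g.coeff k)
          ≤ (V.valuation (g.coeff m))⁻¹ * V.valuation (g.coeff m) := by
            gcongr
            exact hmax k (mem_support_iff.mpr hk')
        _ = 1 := inv_mul_cancel₀ h0
  refine ⟨g.coeff m, g₁, ?_, fun h ↦ ?_⟩
  · rw [hg₁, ← mul_assoc, ← C_mul, mul_inv_cancel₀ hc, C_1, one_mul]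
  · have h1 : g₁.coeff m = 1 := V.subtype_injective <| by
      rw [← coeff_map, hg₁, coeff_C_mul, inv_mul_cancel₀ hc, map_one]
    simpa [coeff_map, h1] using congr(coeff m $h)

/-- A factorization over `K` of a polynomial over a valuation subring of `K` induces a
factorization of its reduction with the same degrees, if reduction preserves the degree. -/
theorem exists_map_residue_eq_mul {K : Type*} [Field K] (V : ValuationSubring K)
    {f : MvPolynomial σ V} (hf : map (IsLocalRing.residue V) f ≠ 0)
    (hdeg : (map (IsLocalRing.residue V) f).totalDegree = f.totalDegree)
    {g h : MvPolynomial σ K} (hfgh : map V.subtype f = g * h) :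
    ∃ g' h' : MvPolynomial σ (IsLocalRing.ResidueField V),
      map (IsLocalRing.residue V) f = g' * h' ∧
        g'.totalDegree = g.totalDegree ∧ h'.totalDegree = h.totalDegree := by
  have hf0 : map V.subtype f ≠ 0 := fun h0 ↦ hf <| by
    rw [(map_injective _ V.subtype_injective) (h0.trans (map_zero _).symm), map_zero]
  have hg0 : g ≠ 0 := by rintro rfl; simp [hfgh] at hf0
  have hh0 : h ≠ 0 := by rintro rfl; simp [hfgh] at hf0
  obtain ⟨c, g₁, hg, hg₁⟩ := exists_eq_C_mul_map_subtype V hg0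
  obtain ⟨d, h₁, hh, hh₁⟩ := exists_eq_C_mul_map_subtype V hh0
  have hfac : map V.subtype f = C (c * d) * map V.subtype (g₁ * h₁) := by
    rw [hfgh, hg, hh, C_mul, map_mul]; ring
  obtain ⟨m, hm⟩ := ne_zero_iff.mp (mul_ne_zero hg₁ hh₁)
  rw [← map_mul, coeff_map, IsLocalRing.residue_ne_zero_iff_isUnit] at hm
  obtain ⟨u, hu⟩ := hm
  obtain ⟨e, he⟩ : ∃ e : V, V.subtype e = c * d := by
    refine ⟨f.coeff m * ↑u⁻¹, ?_⟩
    have h1 := congr(coeff m $hfac)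
    rw [coeff_map, coeff_C_mul, coeff_map, ← hu] at h1
    rw [map_mul, h1, mul_assoc, ← map_mul, Units.mul_inv, map_one, mul_one]
  have hfe : f = C e * g₁ * h₁ := map_injective _ V.subtype_injective <| by
    rw [hfac, mul_assoc, map_mul _ (C e), map_C, he]
  have hge : map V.subtype (C e * g₁) = C d * g := by
    rw [map_mul, map_C, he, hg, C_mul]; ring
  have hmul : map (IsLocalRing.residue V) f =
      map (IsLocalRing.residue V) (C e * g₁) * map (IsLocalRing.residue V) h₁ := by
    rw [← map_mul, ← hfe]
  have hg' : (map (IsLocalRing.residue V) (C e * g₁)).totalDegree ≤ g.totalDegree := by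
    refine (totalDegree_map_le_totalDegree _ _).trans ?_
    rw [← totalDegree_map_eq_of_injective V.subtype_injective, hge]
    exact (totalDegree_mul _ _).trans (by simp)
  have hh' : (map (IsLocalRing.residue V) h₁).totalDegree ≤ h.totalDegree := by
    have hd : d ≠ 0 := by rintro rfl; simp [hh] at hh0
    have : map V.subtype h₁ = C d⁻¹ * h := by
      rw [hh, ← mul_assoc, ← C_mul, inv_mul_cancel₀ hd, C_1, one_mul]
    refine (totalDegree_map_le_totalDegree _ _).trans ?_
    rw [← totalDegree_map_eq_of_injective V.subtype_injective, this]
    exact (totalDegree_mul _ _).trans (by simp)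
  have hsum : (map (IsLocalRing.residue V) (C e * g₁)).totalDegree +
      (map (IsLocalRing.residue V) h₁).totalDegree = g.totalDegree + h.totalDegree := by
    have hne := hmul ▸ hf
    rw [← totalDegree_mul_of_isDomain (left_ne_zero_of_mul hne) (right_ne_zero_of_mul hne),
      ← hmul, hdeg, ← totalDegree_map_eq_of_injective V.subtype_injective, hfgh,
      totalDegree_mul_of_isDomain hg0 hh0]
  exact ⟨_, _, hmul, by omega, by omega⟩

/-- A polynomial over `E` that splits into nonconstant factors over some extension field is
not irreducible over an algebraically closed extension of `E`. -/
theorem not_irreducible_map_of_map_eq_mul {E k L : Type*} [Field E] [Field k] [Field L]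
    [Algebra E k] [Algebra E L] [IsAlgClosed L] {f : MvPolynomial σ E} {g h : MvPolynomial σ k}
    (hfgh : map (algebraMap E k) f = g * h) (hg : g.totalDegree ≠ 0) (hh : h.totalDegree ≠ 0) :
    ¬ Irreducible (map (algebraMap E L) f) := by
  classical
  obtain ⟨m, hm, hgm⟩ := exists_coeff_ne_zero_of_totalDegree_ne_zero hg
  obtain ⟨l, hl, hhl⟩ := exists_coeff_ne_zero_of_totalDegree_ne_zero hh
  let s : Finset k := insert (g.coeff m * h.coeff l)⁻¹ (g.coeffs ∪ h.coeffs)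
  let A := Algebra.adjoin E (s : Set k)
  have hsA : (s : Set k) ⊆ A := Algebra.subset_adjoin
  have : Algebra.FiniteType E A :=
    A.fg_iff_finiteType.mp ⟨s, rfl⟩
  have hval : Function.Injective (A.val : A →+* k) := Subtype.val_injective
  have hlift {q : MvPolynomial σ k} (hq : q.coeffs ⊆ s) :
      ∃ q₁ : MvPolynomial σ A, map (A.val : A →+* k) q₁ = q :=
    mem_range_map_iff_coeffs_subset.mpr fun x hx ↦ ⟨⟨x, hsA (hq hx)⟩, rfl⟩
  obtain ⟨g₁, hg₁⟩ := hlift (q := g) fun x hx ↦ by simp [s, hx]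
  obtain ⟨h₁, hh₁⟩ := hlift (q := h) fun x hx ↦ by simp [s, hx]
  obtain ⟨φ⟩ := nonempty_algHom_of_finiteType E A L
  have hfA : map (algebraMap E A) f = g₁ * h₁ := map_injective _ hval <| by
    rw [map_map, map_mul, hg₁, hh₁, ← hfgh]
    rfl
  have hfL : map (algebraMap E L) f = map (φ : A →+* L) g₁ * map (φ : A →+* L) h₁ := by
    rw [← map_mul, ← hfA, map_map, φ.comp_algebraMap]
  have hunit : IsUnit (g₁.coeff m * h₁.coeff l) := by
    refine IsUnit.of_mul_eq_one ⟨_, hsA (Finset.mem_insert_self _ _)⟩ (hval ?_)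
    rw [map_mul, map_mul, map_one, ← coeff_map, ← coeff_map, hg₁, hh₁]
    exact mul_inv_cancel₀ (mul_ne_zero hgm hhl)
  have hne := (hunit.map (φ : A →+* L)).ne_zero
  rw [map_mul] at hne
  intro hirr
  rcases hirr.isUnit_or_isUnit hfL with hu | hu
  · exact not_isUnit_of_coeff_ne_zero hm (by simpa [coeff_map] using left_ne_zero_of_mul hne) hu
  · exact not_isUnit_of_coeff_ne_zero hl (by simpa [coeff_map] using right_ne_zero_of_mul hne) hu

end MvPolynomial

/-- A field of characteristic zero has a valuation subring of residue characteristic `p`. -/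
theorem ValuationSubring.exists_charP_residueField (K : Type*) [Field K] [CharZero K] (p : ℕ)
    [Fact p.Prime] :
    ∃ V : ValuationSubring K, CharP (IsLocalRing.ResidueField V) p := by
  have hp : p.Prime := Fact.out
  let A : Subring K := (Int.castRingHom K).range
  have hI : Ideal.span {(p : A)} ≠ ⊤ := by
    rw [Ne, Ideal.span_singleton_eq_top, isUnit_iff_exists_inv]
    rintro ⟨⟨_, a, rfl⟩, ha⟩
    have h1 : ((p * a : ℤ) : K) = (1 : ℤ) := by simpa using congr(A.subtype $ha)
    have h2 : (p : ℤ) ∣ 1 := ⟨a, (Int.cast_injective h1).symm⟩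
    exact hp.one_lt.ne' (Nat.dvd_one.mp (by exact_mod_cast h2))
  obtain ⟨V, -, hV⟩ := Ideal.image_subset_nonunits_valuationSubring _ hI
  refine ⟨V, (CharP.charP_iff_prime_eq_zero hp).mpr ?_⟩
  have hpV : ((p : V) : K) ∈ V.nonunits :=
    hV ⟨p, Ideal.subset_span rfl, by simp⟩
  rw [V.coe_mem_nonunits_iff, ← IsLocalRing.residue_eq_zero_iff, map_natCast] at hpV
  exact hpV

/-- If `f ∈ ℤ[x₁,...,xₙ]` and its reduction `f̄` modulo a prime `p` satisfies
`deg f = deg f̄` and `f̄` is irreducible over the algebraic closure of `𝔽_p`, then `f` is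
irreducible over `ℂ` (absolutely irreducible). -/
theorem stmt5 (n : ℕ) (p : ℕ) [Fact p.Prime] (f : MvPolynomial (Fin n) ℤ)
    (fbar : MvPolynomial (Fin n) (ZMod p))
    (hfbar : fbar = MvPolynomial.map (Int.castRingHom (ZMod p)) f)
    (hdeg : f.totalDegree = fbar.totalDegree)
    (hirr : Irreducible
      (MvPolynomial.map (algebraMap (ZMod p) (AlgebraicClosure (ZMod p))) fbar)) :
    Irreducible (MvPolynomial.map (Int.castRingHom ℂ) f) := by
  have hbar0 : fbar ≠ 0 := by rintro rfl; simp at hirr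
  have hbardeg : fbar.totalDegree ≠ 0 := by
    rw [← totalDegree_map_eq_of_injective
      (algebraMap (ZMod p) (AlgebraicClosure (ZMod p))).injective]
    exact fun h ↦ hirr.not_isUnit ((isUnit_iff_totalDegree_eq_zero hirr.ne_zero).mpr h)
  have hinj : Function.Injective (Int.castRingHom ℂ) := Int.cast_injective
  have hf0 : f ≠ 0 := by rintro rfl; simp [hfbar] at hbar0
  have hfC : map (Int.castRingHom ℂ) f ≠ 0 :=
    (map_ne_zero_iff _ (map_injective _ hinj)).mpr hf0
  refine ⟨fun hu ↦ hbardeg ?_, fun {g h} hgh ↦ ?_⟩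
  · rw [← hdeg, ← totalDegree_map_eq_of_injective hinj]
    exact (isUnit_iff_totalDegree_eq_zero hfC).mp hu
  have hgh0 := hgh ▸ hfC
  rw [isUnit_iff_totalDegree_eq_zero (left_ne_zero_of_mul hgh0),
    isUnit_iff_totalDegree_eq_zero (right_ne_zero_of_mul hgh0)]
  by_contra! hne
  obtain ⟨V, hV⟩ := ValuationSubring.exists_charP_residueField ℂ p
  let := ZMod.algebra (IsLocalRing.ResidueField V) p
  have hred : map (IsLocalRing.residue V) (map (Int.castRingHom V) f) =
      map (algebraMap (ZMod p) (IsLocalRing.ResidueField V)) fbar := by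
    rw [hfbar, map_map, map_map]
    congr 1
    exact congrArg _ (RingHom.ext_int _ _)
  have hinjk := (algebraMap (ZMod p) (IsLocalRing.ResidueField V)).injective
  have hVC : map V.subtype (map (Int.castRingHom V) f) = map (Int.castRingHom ℂ) f := by
    rw [map_map]
    exact congr(map $(RingHom.ext_int _ _) f)
  obtain ⟨g', h', hmul, hg', hh'⟩ := exists_map_residue_eq_mul V
    (by rw [hred]; exact (map_ne_zero_iff _ (map_injective _ hinjk)).mpr hbar0)
    (by rw [hred, totalDegree_map_eq_of_injective hinjk, ← hdeg,
      ← totalDegree_map_eq_of_injective V.subtype_injective, hVC,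
      totalDegree_map_eq_of_injective hinj])
    (hVC.trans hgh)
  exact not_irreducible_map_of_map_eq_mul (hred.symm.trans hmul) (hg'.trans_ne hne.1)
    (hh'.trans_ne hne.2) hirr
end

section
/- Let f ∈ K[x_1,...,x_n] be irreducible over the field K, and suppose the greatest common divisor of all coordinates of all vertices of the Newton polytope P_f equals 1. Then f is absolutely irreducible, i.e., irreducible over the algebraic closure K̄. -/
open MvPolynomial

/-- The Newton polytope of a multivariate polynomial: the convex hull in `ℝ^n` of the
exponent vectors of the monomials with nonzero coefficient. -/
noncomputable def newtonPolytope {n : ℕ} {R : Type*} [CommSemiring R]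
    (f : MvPolynomial (Fin n) R) : Set (Fin n → ℝ) :=
  convexHull ℝ ((fun u : Fin n →₀ ℕ => fun i => (u i : ℝ)) '' (f.support : Set (Fin n →₀ ℕ)))

namespace MvPolynomial

section Weight

variable {σ R : Type*} [CommRing R] (φ : (σ →₀ ℕ) →+ ℝ)

/-- `m` is the maximum of the weight `φ` over the exponents of `p`. -/
def IsTopWeight (p : MvPolynomial σ R) (m : ℝ) : Prop :=
  IsGreatest (φ '' (p.support : Set (σ →₀ ℕ))) m

variable {φ}

theorem IsTopWeight.le {p : MvPolynomial σ R} {m : ℝ} (h : IsTopWeight φ p m)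
    {u : σ →₀ ℕ} (hu : u ∈ p.support) : φ u ≤ m :=
  h.2 ⟨u, hu, rfl⟩

theorem IsTopWeight.unique {p : MvPolynomial σ R} {m m' : ℝ} (h : IsTopWeight φ p m)
    (h' : IsTopWeight φ p m') : m = m' :=
  IsGreatest.unique h h'

variable (φ) in
theorem exists_isTopWeight {p : MvPolynomial σ R} (hp : p ≠ 0) : ∃ m, IsTopWeight φ p m := by
  obtain ⟨u, hu, hmax⟩ := p.support.exists_max_image φ (support_nonempty.2 hp)
  refine ⟨φ u, ⟨u, hu, rfl⟩, ?_⟩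
  rintro _ ⟨v, hv, rfl⟩
  exact hmax v hv

theorem mul_mem_restrictSupport {p q : MvPolynomial σ R} {a b : ℝ}
    (hp : p ∈ restrictSupport R {u | φ u ≤ a}) (hq : q ∈ restrictSupport R {u | φ u ≤ b}) :
    p * q ∈ restrictSupport R {u | φ u ≤ a + b} := by
  classical
  rw [mem_restrictSupport_iff] at *
  intro u hu
  obtain ⟨x, hx, y, hy, rfl⟩ := Finset.mem_add.1 (support_mul p q hu)
  have h₁ : φ x ≤ a := hp hx
  have h₂ : φ y ≤ b := hq hy
  simpa using add_le_add h₁ h₂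

theorem prod_mem_restrictSupport {ι : Type*} (s : Finset ι) {p : ι → MvPolynomial σ R} {a : ℝ}
    (hp : ∀ i ∈ s, p i ∈ restrictSupport R {u | φ u ≤ a}) :
    ∏ i ∈ s, p i ∈ restrictSupport R {u | φ u ≤ s.card * a} := by
  classical
  induction s using Finset.induction_on with
  | empty =>
    rw [mem_restrictSupport_iff]
    intro u hu
    have hu : u ∈ (C 1 : MvPolynomial σ R).support := by simpa using hu
    obtain rfl : u = 0 := by
      by_contra h
      rw [mem_support_iff, coeff_C, if_neg (Ne.symm h)] at hu
      exact hu rfl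
    simp
  | insert i s hi ih =>
    rw [Finset.prod_insert hi, Finset.card_insert_of_notMem hi]
    have := mul_mem_restrictSupport (hp i (Finset.mem_insert_self i s))
      (ih fun j hj => hp j (Finset.mem_insert_of_mem hj))
    rwa [show a + s.card * a = ((s.card + 1 : ℕ) : ℝ) * a by push_cast; ring] at this

theorem det_mem_restrictSupport {ι : Type*} [Fintype ι] [DecidableEq ι]
    {M : Matrix ι ι (MvPolynomial σ R)} {a : ℝ}
    (hM : ∀ i j, M i j ∈ restrictSupport R {u | φ u ≤ a}) :
    M.det ∈ restrictSupport R {u | φ u ≤ Fintype.card ι * a} := by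
  rw [Matrix.det_apply]
  refine Submodule.sum_mem _ fun τ _ => ?_
  have := prod_mem_restrictSupport Finset.univ fun i _ => hM (τ i) i
  rw [Finset.card_univ] at this
  rcases Int.units_eq_one_or (Equiv.Perm.sign τ) with h | h
  · simpa [h] using this
  · simpa [h] using Submodule.neg_mem _ this

theorem isTopWeight_C {c : R} (hc : c ≠ 0) : IsTopWeight φ (C c) 0 := by
  classical
  rw [IsTopWeight, support_C, if_neg hc]
  simp

theorem IsTopWeight.mul [IsDomain R] {p q : MvPolynomial σ R} {a b : ℝ}
    (hp : IsTopWeight φ p a) (hq : IsTopWeight φ q b) : IsTopWeight φ (p * q) (a + b) := by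
  classical
  have hle : ∀ u ∈ (p * q).support, φ u ≤ a + b := fun u hu =>
    ((mem_restrictSupport_iff _).1 (mul_mem_restrictSupport (φ := φ)
      ((mem_restrictSupport_iff _).2 fun _ h => hp.le h)
      ((mem_restrictSupport_iff _).2 fun _ h => hq.le h))) hu
  let top (r : MvPolynomial σ R) (m : ℝ) : MvPolynomial σ R :=
    ∑ u ∈ r.support with φ u = m, monomial u (coeff u r)
  have coeff_top (r m u) : coeff u (top r m) = if φ u = m then coeff u r else 0 := by
    simp only [top, coeff_sum, coeff_monomial, Finset.sum_ite_eq', Finset.mem_filter,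
      mem_support_iff]
    split_ifs <;> simp_all
  have top_ne {r m} (h : IsTopWeight φ r m) : top r m ≠ 0 := by
    obtain ⟨u, hu, hum⟩ := h.1
    intro h0
    have := coeff_top r m u
    rw [h0, if_pos hum, coeff_zero] at this
    exact mem_support_iff.1 hu this.symm
  obtain ⟨u, hu⟩ := ne_zero_iff.1 (mul_ne_zero (top_ne hp) (top_ne hq))
  have hφu : φ u = a + b := by
    rw [coeff_mul] at hu
    obtain ⟨⟨x, y⟩, hxy, hne⟩ := Finset.exists_ne_zero_of_sum_ne_zero hu
    rw [Finset.HasAntidiagonal.mem_antidiagonal] at hxy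
    simp only [coeff_top] at hne
    have hx : φ x = a := by by_contra h; simp [h] at hne
    have hy : φ y = b := by by_contra h; simp [h] at hne
    rw [← hxy, map_add, hx, hy]
  have heq : coeff u (p * q) = coeff u (top p a * top q b) := by
    rw [coeff_mul, coeff_mul]
    refine Finset.sum_congr rfl fun ⟨x, y⟩ hxy => ?_
    rw [Finset.HasAntidiagonal.mem_antidiagonal] at hxy
    have hsum : φ x + φ y = a + b := by rw [← map_add, hxy, hφu]
    simp only [coeff_top]
    by_cases hx : x ∈ p.support
    · by_cases hy : y ∈ q.support
      · have h₁ := hp.le hx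
        have h₂ := hq.le hy
        rw [if_pos (by linarith), if_pos (by linarith)]
      · simp [notMem_support_iff.1 hy]
    · simp [notMem_support_iff.1 hx]
  refine ⟨⟨u, mem_support_iff.2 (heq ▸ hu), hφu⟩, ?_⟩
  rintro _ ⟨v, hv, rfl⟩
  exact hle v hv

theorem IsTopWeight.pow [IsDomain R] {p : MvPolynomial σ R} {a : ℝ}
    (hp : IsTopWeight φ p a) (k : ℕ) : IsTopWeight φ (p ^ k) (k * a) := by
  induction k with
  | zero => simpa using isTopWeight_C (φ := φ) (one_ne_zero (α := R))
  | succ k ih =>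
    rw [pow_succ]
    convert ih.mul hp using 1
    push_cast
    ring

theorem IsTopWeight.of_associated [IsDomain R] {p q : MvPolynomial σ R} {a : ℝ}
    (hp : IsTopWeight φ p a) (h : Associated p q) : IsTopWeight φ q a := by
  obtain ⟨v, rfl⟩ := h
  obtain ⟨c, hc, hv⟩ := isUnit_iff_eq_C_of_isReduced.1 v.isUnit
  rw [hv]
  simpa using hp.mul (isTopWeight_C hc.ne_zero)

theorem isUnit_of_isTopWeight_zero {K : Type*} [Field K] {p : MvPolynomial σ K} (hp : p ≠ 0)
    (h : ∀ φ : (σ →₀ ℕ) →+ ℝ, IsTopWeight φ p 0) : IsUnit p := by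
  have hsupp : ∀ u ∈ p.support, u = 0 := by
    intro u hu
    ext i
    have := (h ((Nat.castAddMonoidHom ℝ).comp (Finsupp.applyAddHom i))).le hu
    simpa using this
  have hC : p = C (coeff 0 p) := by
    classical
    ext u
    rw [coeff_C]
    split_ifs with h0
    · rw [h0]
    · exact notMem_support_iff.1 fun hu => h0 (hsupp u hu).symm
  refine isUnit_iff_eq_C_of_isReduced.2 ⟨_, IsUnit.mk0 _ fun h0 => hp ?_, hC⟩
  rw [hC, h0, C_0]

end Weight

section RegularRepresentation

variable {σ ι K E : Type*} [Field K] [Field E] [Algebra K E] [Fintype ι] [DecidableEq ι]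
  (b : Module.Basis ι K E)

/-- The matrix, over `MvPolynomial σ K`, of multiplication by a polynomial over `E`, with
respect to a `K`-basis of `E`. -/
noncomputable def leftMulMatrix (p : MvPolynomial σ E) : Matrix ι ι (MvPolynomial σ K) :=
  fun i j => ∑ u ∈ p.support, monomial u (Algebra.leftMulMatrix b (coeff u p) i j)

theorem coeff_leftMulMatrix (p : MvPolynomial σ E) (i j : ι) (u : σ →₀ ℕ) :
    coeff u (leftMulMatrix b p i j) = Algebra.leftMulMatrix b (coeff u p) i j := by
  classical
  simp only [leftMulMatrix, coeff_sum, coeff_monomial, Finset.sum_ite_eq', mem_support_iff]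
  split_ifs with h
  · rfl
  · rw [not_not.1 h, map_zero, Matrix.zero_apply]

theorem support_leftMulMatrix_subset (p : MvPolynomial σ E) (i j : ι) :
    (leftMulMatrix b p i j).support ⊆ p.support := by
  intro u
  rw [mem_support_iff, mem_support_iff, coeff_leftMulMatrix]
  contrapose!
  intro h
  rw [h, map_zero, Matrix.zero_apply]

theorem leftMulMatrix_mul (p q : MvPolynomial σ E) :
    leftMulMatrix b (p * q) = leftMulMatrix b p * leftMulMatrix b q := by
  classical
  ext i j u
  rw [coeff_leftMulMatrix, Matrix.mul_apply, coeff_sum, coeff_mul, map_sum, Matrix.sum_apply]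
  simp only [coeff_mul, coeff_leftMulMatrix, map_mul, Matrix.mul_apply]
  exact Finset.sum_comm

theorem leftMulMatrix_map (f : MvPolynomial σ K) :
    leftMulMatrix b (map (algebraMap K E) f) = Matrix.scalar ι f := by
  ext i j u
  rw [coeff_leftMulMatrix, coeff_map, AlgHom.commutes, Matrix.algebraMap_matrix_apply,
    Matrix.scalar_apply, Matrix.diagonal_apply]
  split_ifs <;> simp

theorem det_leftMulMatrix_mem_restrictSupport {φ : (σ →₀ ℕ) →+ ℝ} {p : MvPolynomial σ E} {a : ℝ}
    (hp : IsTopWeight φ p a) :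
    (leftMulMatrix b p).det ∈ restrictSupport K {u | φ u ≤ Fintype.card ι * a} :=
  det_mem_restrictSupport fun i j =>
    (mem_restrictSupport_iff _).2 fun _ hu => hp.le (support_leftMulMatrix_subset b p i j hu)

theorem det_leftMulMatrix_mul_of_mul_eq_map {f : MvPolynomial σ K} {g h : MvPolynomial σ E}
    (hgh : g * h = map (algebraMap K E) f) :
    (leftMulMatrix b g).det * (leftMulMatrix b h).det = f ^ Fintype.card ι := by
  rw [← Matrix.det_mul, ← leftMulMatrix_mul, hgh, leftMulMatrix_map, Matrix.scalar_apply,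
    Matrix.det_diagonal, Finset.prod_const, Finset.card_univ]

theorem support_map_algebraMap (f : MvPolynomial σ K) :
    (map (algebraMap K E) f).support = f.support :=
  support_map_of_injective f (algebraMap K E).injective

/-- In a factorization over `E` of a polynomial over `K`, the top weights of the norm of a factor
are `[E : K]` times those of the factor. -/
theorem isTopWeight_det_leftMulMatrix {f : MvPolynomial σ K} (hf : f ≠ 0)
    {g h : MvPolynomial σ E} (hgh : g * h = map (algebraMap K E) f)
    {φ : (σ →₀ ℕ) →+ ℝ} {m : ℝ} (hm : IsTopWeight φ g m) :
    IsTopWeight φ (leftMulMatrix b g).det (Fintype.card ι * m) := by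
  have hdet := det_leftMulMatrix_mul_of_mul_eq_map b hgh
  have hne := hdet ▸ pow_ne_zero (Fintype.card ι) hf
  have hF : g * h ≠ 0 := by
    rw [hgh]
    exact (map_ne_zero_iff _ (map_injective _ (algebraMap K E).injective)).2 hf
  obtain ⟨m', hm'⟩ := exists_isTopWeight φ (right_ne_zero_of_mul hF)
  obtain ⟨s, hs⟩ := exists_isTopWeight φ (left_ne_zero_of_mul hne)
  obtain ⟨t, ht⟩ := exists_isTopWeight φ (right_ne_zero_of_mul hne)
  have hf_top : IsTopWeight φ f (m + m') := by
    have := hm.mul hm'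
    rwa [hgh, IsTopWeight, support_map_algebraMap] at this
  have hst : s + t = Fintype.card ι * (m + m') :=
    (hs.mul ht).unique (hdet ▸ hf_top.pow _)
  have hs_le : s ≤ Fintype.card ι * m := by
    obtain ⟨u, hu, rfl⟩ := hs.1
    exact (mem_restrictSupport_iff _).1 (det_leftMulMatrix_mem_restrictSupport b hm) hu
  have ht_le : t ≤ Fintype.card ι * m' := by
    obtain ⟨u, hu, rfl⟩ := ht.1
    exact (mem_restrictSupport_iff _).1 (det_leftMulMatrix_mem_restrictSupport b hm') hu
  convert hs using 1
  linarith

end RegularRepresentation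

end MvPolynomial

section Convex

open scoped Pointwise

variable {V : Type*} [AddCommGroup V] [Module ℝ V] [TopologicalSpace V] [IsTopologicalAddGroup V]
  [ContinuousSMul ℝ V] [LocallyConvexSpace ℝ V] [T2Space V]

theorem subset_convexHull_of_isGreatest {s t : Set V} (ht : t.Finite)
    (h : ∀ l : V →L[ℝ] ℝ, ∃ m, IsGreatest (l '' s) m ∧ IsGreatest (l '' t) m) :
    s ⊆ convexHull ℝ t := by
  intro x hx
  by_contra hxt
  obtain ⟨l, c, hlt, hlx⟩ := geometric_hahn_banach_closed_point (convex_convexHull ℝ t)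
    (ht.isClosed_convexHull ℝ) hxt
  obtain ⟨m, hs, ⟨y, hy, rfl⟩, -⟩ := h l
  have h₁ := hs.2 ⟨x, hx, rfl⟩
  have h₂ := hlt y (subset_convexHull ℝ t hy)
  linarith

theorem convexHull_eq_of_isGreatest {s t : Set V} (hs : s.Finite) (ht : t.Finite)
    (h : ∀ l : V →L[ℝ] ℝ, ∃ m, IsGreatest (l '' s) m ∧ IsGreatest (l '' t) m) :
    convexHull ℝ s = convexHull ℝ t :=
  (convexHull_min (subset_convexHull_of_isGreatest ht h) (convex_convexHull ℝ t)).antisymm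
    (convexHull_min (subset_convexHull_of_isGreatest hs fun l =>
      (h l).imp fun _ hm => hm.symm) (convex_convexHull ℝ s))

theorem smul_mem_of_isGreatest_of_mem_extremePoints {s t : Set V} (hs : s.Finite) (ht : t.Finite)
    {c : ℝ} (hc : 0 < c)
    (h : ∀ l : V →L[ℝ] ℝ, ∃ m, IsGreatest (l '' s) m ∧ IsGreatest (l '' t) (c * m))
    {x : V} (hx : x ∈ Set.extremePoints ℝ (convexHull ℝ s)) : c • x ∈ t := by
  have hull : c • convexHull ℝ s = convexHull ℝ t := by
    rw [← convexHull_smul]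
    refine convexHull_eq_of_isGreatest (hs.smul_set) ht fun l => ?_
    obtain ⟨m, ⟨⟨y, hy, rfl⟩, hm⟩, hm'⟩ := h l
    refine ⟨_, ⟨⟨c • y, Set.smul_mem_smul_set hy, by simp⟩, ?_⟩, hm'⟩
    rintro _ ⟨_, ⟨z, hz, rfl⟩, rfl⟩
    simpa using mul_le_mul_of_nonneg_left (hm ⟨z, hz, rfl⟩) hc.le
  refine extremePoints_convexHull_subset (𝕜 := ℝ) ?_
  rw [← hull]
  have := image_extremePoints (LinearEquiv.smulOfNeZero ℝ V c hc.ne') (convexHull ℝ s)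
  exact this ▸ ⟨x, hx, rfl⟩

end Convex

namespace MvPolynomial

theorem dvd_mul_of_mem_extremePoints_newtonPolytope {n : ℕ} {K E : Type*} [Field K] [Field E]
    {f : MvPolynomial (Fin n) K} (hf : f ≠ 0) {g : MvPolynomial (Fin n) E} {a d : ℕ} (hd : d ≠ 0)
    (h : ∀ φ m M, IsTopWeight φ g m → IsTopWeight φ f M → d * m = a * M)
    (hg : g ≠ 0) {u : Fin n →₀ ℕ}
    (hu : (fun i => (u i : ℝ)) ∈ Set.extremePoints ℝ (newtonPolytope f)) (i : Fin n) :
    d ∣ a * u i := by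
  rcases Nat.eq_zero_or_pos a with rfl | ha
  · simp
  have hd' : (d : ℝ) ≠ 0 := Nat.cast_ne_zero.2 hd
  have hd_pos : (0 : ℝ) < d := Nat.cast_pos.2 (Nat.pos_of_ne_zero hd)
  have ha_pos : (0 : ℝ) < a := Nat.cast_pos.2 ha
  let e : (Fin n →₀ ℕ) →+ (Fin n → ℝ) :=
    { toFun := fun u i => u i
      map_zero' := by ext; simp
      map_add' := fun _ _ => by ext; simp }
  have key : ((a : ℝ) / d) • (e u) ∈ e '' (g.support : Set (Fin n →₀ ℕ)) := by
    refine smul_mem_of_isGreatest_of_mem_extremePoints (f.support.finite_toSet.image e)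
      (g.support.finite_toSet.image e) (div_pos ha_pos hd_pos) (fun l => ?_) hu
    let φ : (Fin n →₀ ℕ) →+ ℝ := (l : (Fin n → ℝ) →+ ℝ).comp e
    obtain ⟨M, hM⟩ := exists_isTopWeight φ hf
    obtain ⟨m, hm⟩ := exists_isTopWeight φ hg
    have hmM : (a : ℝ) / d * M = m := by
      have := h φ m M hm hM
      field_simp
      linarith
    refine ⟨M, ?_, ?_⟩
    · rw [Set.image_image]
      exact hM
    · rw [Set.image_image, hmM]
      exact hm
  obtain ⟨v, -, hv⟩ := key
  refine ⟨v i, ?_⟩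
  have hvi : (v i : ℝ) = (a : ℝ) / d * u i := congrFun hv i
  have : (a * u i : ℝ) = d * v i := by
    rw [hvi]
    field_simp
  exact_mod_cast this

/-- Gao's criterion over a finite extension. -/
theorem isUnit_or_isUnit_of_mul_eq_map {n : ℕ} {K E : Type*} [Field K] [Field E] [Algebra K E]
    [FiniteDimensional K E] {f : MvPolynomial (Fin n) K} (hirr : Irreducible f)
    (hgcd : ∀ d : ℕ,
      (∀ u ∈ f.support,
        (fun i => (u i : ℝ)) ∈ Set.extremePoints ℝ (newtonPolytope f) → ∀ i, d ∣ u i) →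
      d = 1)
    {g h : MvPolynomial (Fin n) E} (hgh : g * h = map (algebraMap K E) f) :
    IsUnit g ∨ IsUnit h := by
  have hf := hirr.ne_zero
  have hF : g * h ≠ 0 := by
    rw [hgh]
    exact (map_ne_zero_iff _ (map_injective _ (algebraMap K E).injective)).2 hf
  have hg := left_ne_zero_of_mul hF
  have hh := right_ne_zero_of_mul hF
  let b := Module.finBasis K E
  set d := Module.finrank K E
  have hd : 0 < d := Module.finrank_pos
  have hdR : (d : ℝ) ≠ 0 := Nat.cast_ne_zero.2 hd.ne'
  have hdvd : (leftMulMatrix b g).det ∣ f ^ d :=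
    ⟨_, by simpa using (det_leftMulMatrix_mul_of_mul_eq_map b hgh).symm⟩
  obtain ⟨a, had, hassoc⟩ := (dvd_prime_pow hirr.prime d).1 hdvd
  have hweight : ∀ φ m M, IsTopWeight φ g m → IsTopWeight φ f M → d * m = a * M := by
    intro φ m M hm hM
    have h₁ := isTopWeight_det_leftMulMatrix b hf hgh hm
    rw [Fintype.card_fin] at h₁
    exact (h₁.of_associated hassoc).unique (hM.pow a)
  have hda : d ∣ a := by
    have hpos : 0 < d.gcd a := Nat.gcd_pos_of_pos_left a hd
    have : d / d.gcd a = 1 := hgcd _ fun u _ hu i => by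
      have h₁ := dvd_mul_of_mem_extremePoints_newtonPolytope hf hd.ne' hweight hg hu i
      refine (Nat.coprime_div_gcd_div_gcd hpos).dvd_of_dvd_mul_left ?_
      rw [Nat.div_mul_right_comm (Nat.gcd_dvd_right d a)]
      exact Nat.div_dvd_div (Nat.gcd_dvd_left d a) h₁
    rw [← Nat.eq_of_dvd_of_div_eq_one (Nat.gcd_dvd_left d a) this]
    exact Nat.gcd_dvd_right d a
  rcases Nat.eq_zero_or_pos a with rfl | ha
  · left
    refine isUnit_of_isTopWeight_zero hg fun φ => ?_
    obtain ⟨M, hM⟩ := exists_isTopWeight φ hf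
    obtain ⟨m, hm⟩ := exists_isTopWeight φ hg
    have := hweight φ m M hm hM
    obtain rfl : m = 0 := by simpa [hdR] using this
    exact hm
  · right
    have had : a = d := le_antisymm had (Nat.le_of_dvd ha hda)
    refine isUnit_of_isTopWeight_zero hh fun φ => ?_
    obtain ⟨M, hM⟩ := exists_isTopWeight φ hf
    obtain ⟨m, hm⟩ := exists_isTopWeight φ hg
    obtain ⟨m', hm'⟩ := exists_isTopWeight φ hh
    have h₁ : m = M := by simpa [had, hdR] using hweight φ m M hm hM
    have h₂ : IsTopWeight φ (g * h) M := by
      rwa [hgh, IsTopWeight, support_map_algebraMap]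
    have h₃ := (hm.mul hm').unique h₂
    obtain rfl : m' = 0 := by linarith
    exact hm'

theorem exists_map_eq_map_eq_of_isAlgebraic {σ K L : Type*} [Field K] [Field L] [Algebra K L]
    [Algebra.IsAlgebraic K L] (p q : MvPolynomial σ L) :
    ∃ E : IntermediateField K L, FiniteDimensional K E ∧ ∃ p' q' : MvPolynomial σ E,
      map (algebraMap E L) p' = p ∧ map (algebraMap E L) q' = q := by
  classical
  let S : Finset L := p.coeffs ∪ q.coeffs
  have hS : (S : Set L) ⊆ Set.range (algebraMap (IntermediateField.adjoin K (S : Set L)) L) :=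
    fun x hx => ⟨⟨x, IntermediateField.subset_adjoin K _ hx⟩, rfl⟩
  refine ⟨IntermediateField.adjoin K (S : Set L),
    IntermediateField.finiteDimensional_adjoin fun x _ => Algebra.IsIntegral.isIntegral x, ?_⟩
  obtain ⟨p', hp'⟩ := mem_range_map_iff_coeffs_subset.2
    (show (p.coeffs : Set L) ⊆ _ from fun x hx => hS (Finset.mem_union_left _ hx))
  obtain ⟨q', hq'⟩ := mem_range_map_iff_coeffs_subset.2
    (show (q.coeffs : Set L) ⊆ _ from fun x hx => hS (Finset.mem_union_right _ hx))
  exact ⟨p', q', hp', hq'⟩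

end MvPolynomial

/-- Gao's criterion: if `f ∈ K[x₁,...,xₙ]` is irreducible over `K` and the greatest common
divisor of all coordinates of all vertices (extreme points) of its Newton polytope is `1`,
then `f` is absolutely irreducible, i.e. irreducible over the algebraic closure of `K`. -/
theorem stmt7 {n : ℕ} {K : Type*} [Field K] (f : MvPolynomial (Fin n) K)
    (hirr : Irreducible f)
    (hgcd : ∀ d : ℕ,
      (∀ u ∈ f.support,
        (fun i => (u i : ℝ)) ∈ Set.extremePoints ℝ (newtonPolytope f) → ∀ i, d ∣ u i) →
      d = 1) :
    Irreducible (MvPolynomial.map (algebraMap K (AlgebraicClosure K)) f) := by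
  refine ⟨fun hunit => hirr.not_isUnit ?_, fun p q hpq => ?_⟩
  · rw [isUnit_iff_totalDegree_of_isReduced] at hunit ⊢
    rw [totalDegree, support_map_algebraMap, coeff_map, isUnit_map_iff] at hunit
    exact hunit
  · obtain ⟨E, _, p, q, rfl, rfl⟩ := exists_map_eq_map_eq_of_isAlgebraic (K := K) p q
    have h : p * q = map (algebraMap K E) f := by
      apply map_injective (algebraMap E (AlgebraicClosure K)) (algebraMap E _).injective
      rw [map_mul, ← hpq, map_map, ← IsScalarTower.algebraMap_eq]
    exact (isUnit_or_isUnit_of_mul_eq_map hirr hgcd h).imp (IsUnit.map _) (IsUnit.map _)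
end
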